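/- Let n ≥ 2 be an integer and p > 1 a real number. For every smooth compactly supported function f : ℝ^n → ℝ with ∫_{ℝ^n} |f|^p dx = 1 one has ∫_{ℝ^n} |f|^p log |f|^p dx ≤ (n/p) log ( L(n,p) ∫_{ℝ^n} |∇f|^p dx ), where the integrand |f|^p log |f|^p is interpreted as 0 at points where f vanishes. -/

import Mathlib

open Real MeasureTheory Filter Topology

/-- The volume of the unit ball in `ℝ^n`: `ω_n = π^(n/2) / Γ(n/2 + 1)`. -/
noncomputable def ballVol (n : ℕ) : ℝ := Real.pi ^ ((n : ℝ) / 2) / Real.Gamma ((n : ℝ) / 2 + 1)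

/-- The sharp constant `L(n,p)` of the `L^p`-logarithmic Sobolev inequality. -/
noncomputable def Lconst (n : ℕ) (p : ℝ) : ℝ :=
  (p / n) * ((p - 1) / Real.exp 1) ^ (p - 1) *
    (ballVol n * Real.Gamma ((n : ℝ) / (p / (p - 1)) + 1)) ^ (-(p / (n : ℝ)))

section PrekopaLeindler

open scoped ENNReal Pointwise

/-- One-dimensional Brunn–Minkowski inequality. -/
lemma volume_add_volume_le {A B C : Set ℝ} (hA : MeasurableSet A) (hB : MeasurableSet B)
    (hA0 : A.Nonempty) (hB0 : B.Nonempty) (hC : ∀ x ∈ A, ∀ y ∈ B, x + y ∈ C) :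
    volume A + volume B ≤ volume C := by
  have compact_case : ∀ K ⊆ A, IsCompact K → K.Nonempty → ∀ L ⊆ B, IsCompact L → L.Nonempty →
      volume K + volume L ≤ volume C := by
    intro K hKA hK hK0 L hLB hL hL0
    have hk := hK.sSup_mem hK0
    have hl := hL.sInf_mem hL0
    have h1 : volume K = volume ((fun x => x + sInf L) '' K) := by
      simp
    have h2 : volume L = volume ((fun x => sSup K + x) '' L) := by
      simp
    rw [h1, h2, ← measure_union₀]
    · apply measure_mono
      rintro _ (⟨x, hx, rfl⟩ | ⟨x, hx, rfl⟩)
      · exact hC _ (hKA hx) _ (hLB hl)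
      · exact hC _ (hKA hk) _ (hLB hx)
    · exact (hL.image (by fun_prop)).measurableSet.nullMeasurableSet
    · refine measure_mono_null (t := {sSup K + sInf L}) ?_ (by simp)
      rintro _ ⟨⟨x, hx, rfl⟩, ⟨y, hy, hxy⟩⟩
      have := le_csSup hK.bddAbove hx
      have := csInf_le hL.bddBelow hy
      simp only at hxy
      simp only [Set.mem_singleton_iff]
      linarith
  obtain ⟨x₀, hx₀⟩ := hA0
  obtain ⟨y₀, hy₀⟩ := hB0
  rw [hA.measure_eq_iSup_isCompact, hB.measure_eq_iSup_isCompact]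
  simp only [iSup_and']
  refine ENNReal.biSup_add_biSup_le' (p := fun K => K ⊆ A ∧ IsCompact K)
    (q := fun L => L ⊆ B ∧ IsCompact L) ⟨∅, by simp⟩ ⟨∅, by simp⟩ ?_
  rintro K ⟨hKA, hK⟩ L ⟨hLB, hL⟩
  refine le_trans (add_le_add (measure_mono (Set.subset_insert x₀ K))
    (measure_mono (Set.subset_insert y₀ L))) ?_
  exact compact_case _ (Set.insert_subset hx₀ hKA) (hK.insert x₀) (Set.insert_nonempty _ _)
    _ (Set.insert_subset hy₀ hLB) (hL.insert y₀) (Set.insert_nonempty _ _)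

lemma geom_mean_le_arith_mean2_weighted_ennreal {a b : ℝ} (ha : 0 < a) (hb : 0 < b)
    (hab : a + b = 1) (x y : ℝ≥0∞) :
    x ^ a * y ^ b ≤ ENNReal.ofReal a * x + ENNReal.ofReal b * y := by
  have hpq : (a⁻¹).HolderConjugate b⁻¹ := by
    rw [Real.holderConjugate_iff]
    refine ⟨(one_lt_inv₀ ha).2 (by linarith), by simpa using hab⟩
  have := ENNReal.young_inequality (x ^ a) (y ^ b) hpq
  rwa [← ENNReal.rpow_mul, ← ENNReal.rpow_mul, mul_inv_cancel₀ ha.ne', mul_inv_cancel₀ hb.ne',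
    ENNReal.rpow_one, ENNReal.rpow_one, ENNReal.ofReal_inv_of_pos ha, ENNReal.ofReal_inv_of_pos hb,
    ENNReal.div_eq_inv_mul, ENNReal.div_eq_inv_mul, inv_inv, inv_inv] at this

lemma arith_lintegral_le_of_iSup_eq_one {a b : ℝ} (ha : 0 < a) (hb : 0 < b) (hab : a + b = 1)
    {u v h : ℝ → ℝ≥0∞} (hu : Measurable u) (hv : Measurable v) (hh : Measurable h)
    (hu1 : ⨆ x, u x = 1) (hv1 : ⨆ x, v x = 1)
    (H : ∀ x y, u x ^ a * v y ^ b ≤ h (a * x + b * y)) :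
    ENNReal.ofReal a * (∫⁻ x, u x) + ENNReal.ofReal b * (∫⁻ x, v x) ≤ ∫⁻ x, h x := by
  have hule : ∀ x, u x ≤ 1 := fun x => hu1 ▸ le_iSup u x
  have hvle : ∀ x, v x ≤ 1 := fun x => hv1 ▸ le_iSup v x
  have layer : ∀ w : ℝ → ℝ≥0∞, Measurable w → (∀ x, w x ≤ 1) →
      ∫⁻ x, w x = ∫⁻ s in Set.Ioi (0 : ℝ), volume {x | ENNReal.ofReal s < w x} := by
    intro w hw hw1
    have hfin : ∀ x, w x ≠ ∞ := fun x => ((hw1 x).trans_lt ENNReal.one_lt_top).ne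
    have := lintegral_eq_lintegral_meas_lt volume (f := fun x => (w x).toReal)
      (ae_of_all _ fun x => ENNReal.toReal_nonneg) hw.ennreal_toReal.aemeasurable
    simp only [ENNReal.ofReal_toReal (hfin _)] at this
    rw [this]
    refine setLIntegral_congr_fun measurableSet_Ioi fun s hs => ?_
    congr 1
    ext x
    exact (ENNReal.ofReal_lt_iff_lt_toReal (le_of_lt hs) (hfin x)).symm
  have hmin : ∫⁻ x, min 1 (h x) ≤ ∫⁻ x, h x := lintegral_mono fun x => min_le_right _ _
  refine le_trans ?_ hmin
  rw [layer u hu hule, layer v hv hvle, layer _ (measurable_const.min hh) fun x => min_le_left _ _,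
    ← lintegral_const_mul' _ _ ENNReal.ofReal_ne_top,
    ← lintegral_const_mul' _ _ ENNReal.ofReal_ne_top]
  refine le_trans (le_lintegral_add _ _) ?_
  refine setLIntegral_mono_ae' measurableSet_Ioi (ae_of_all _ fun s hs => ?_)
  have hs : 0 < s := hs
  rcases lt_or_ge s 1 with hs1 | hs1
  · have hs1' : ENNReal.ofReal s < 1 := by
      rwa [← ENNReal.ofReal_one, ENNReal.ofReal_lt_ofReal_iff one_pos]
    have scale : ∀ (c : ℝ) (_ : 0 < c) (S : Set ℝ),
        ENNReal.ofReal c * volume S = volume (c • S) := by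
      intro c hc S
      rw [Measure.addHaar_smul]
      simp [abs_of_pos hc]
    rw [scale a ha, scale b hb]
    refine volume_add_volume_le ((measurableSet_lt measurable_const hu).const_smul₀ a)
      ((measurableSet_lt measurable_const hv).const_smul₀ b) ?_ ?_ ?_
    · rw [← hu1] at hs1'
      obtain ⟨x, hx⟩ := lt_iSup_iff.1 hs1'
      exact ⟨_, Set.smul_mem_smul_set hx⟩
    · rw [← hv1] at hs1'
      obtain ⟨x, hx⟩ := lt_iSup_iff.1 hs1'
      exact ⟨_, Set.smul_mem_smul_set hx⟩
    · rintro _ ⟨x, hx, rfl⟩ _ ⟨y, hy, rfl⟩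
      have hx : ENNReal.ofReal s < u x := hx
      have hy : ENNReal.ofReal s < v y := hy
      refine lt_min hs1' (lt_of_lt_of_le ?_ (H x y))
      calc ENNReal.ofReal s = ENNReal.ofReal s ^ a * ENNReal.ofReal s ^ b := by
            rw [← ENNReal.rpow_add_of_nonneg _ _ ha.le hb.le, hab, ENNReal.rpow_one]
        _ < _ := ENNReal.mul_lt_mul (ENNReal.rpow_lt_rpow hx ha) (ENNReal.rpow_lt_rpow hy hb)
  · have hs1' : 1 ≤ ENNReal.ofReal s := by simpa using hs1
    have : ∀ w : ℝ → ℝ≥0∞, (∀ x, w x ≤ 1) → {x | ENNReal.ofReal s < w x} = ∅ := by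
      intro w hw
      ext x
      simpa using (hw x).trans hs1'
    rw [this u hule, this v hvle]
    simp

/-- Prékopa–Leindler inequality on the line, for bounded functions. -/
lemma prekopa_leindler_real_of_bdd {a b : ℝ} (ha : 0 < a) (hb : 0 < b) (hab : a + b = 1)
    {u v h : ℝ → ℝ≥0∞} (hu : Measurable u) (hv : Measurable v) (hh : Measurable h)
    (hu1 : ⨆ x, u x ≠ ∞) (hv1 : ⨆ x, v x ≠ ∞)
    (H : ∀ x y, u x ^ a * v y ^ b ≤ h (a * x + b * y)) :
    (∫⁻ x, u x) ^ a * (∫⁻ x, v x) ^ b ≤ ∫⁻ x, h x := by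
  rcases eq_or_ne (⨆ x, u x) 0 with hu0 | hu0
  · have : ∀ x, u x = 0 := by simpa using hu0
    simp [this, ha]
  rcases eq_or_ne (⨆ x, v x) 0 with hv0 | hv0
  · have : ∀ x, v x = 0 := by simpa using hv0
    simp [this, hb]
  set α := ⨆ x, u x
  set β := ⨆ x, v x
  set c := α ^ a * β ^ b with hc
  have hc0 : c ≠ 0 := mul_ne_zero (by simp [hu0, hu1]) (by simp [hv0, hv1])
  have hct : c ≠ ∞ := ENNReal.mul_ne_top (by simp [hu0, hu1]) (by simp [hv0, hv1])
  have hcinv : c⁻¹ = α⁻¹ ^ a * β⁻¹ ^ b := by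
    rw [hc, ENNReal.mul_inv (by simp [hu0, hu1]) (by simp [hu0, hu1]),
      ENNReal.inv_rpow, ENNReal.inv_rpow]
  have key := arith_lintegral_le_of_iSup_eq_one ha hb hab (hu.const_mul α⁻¹) (hv.const_mul β⁻¹)
    (hh.const_mul c⁻¹) (by rw [← ENNReal.mul_iSup]; exact ENNReal.inv_mul_cancel hu0 hu1)
    (by rw [← ENNReal.mul_iSup]; exact ENNReal.inv_mul_cancel hv0 hv1) (by
      intro x y
      rw [ENNReal.mul_rpow_of_nonneg _ _ ha.le, ENNReal.mul_rpow_of_nonneg _ _ hb.le,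
        mul_mul_mul_comm, ← hcinv]
      gcongr
      exact H x y)
  have key := (geom_mean_le_arith_mean2_weighted_ennreal ha hb hab _ _).trans key
  rw [lintegral_const_mul _ hu, lintegral_const_mul _ hv, lintegral_const_mul _ hh,
    ENNReal.mul_rpow_of_nonneg _ _ ha.le, ENNReal.mul_rpow_of_nonneg _ _ hb.le,
        mul_mul_mul_comm, ← hcinv] at key
  exact (ENNReal.mul_le_mul_iff_right (by simpa using hct) (by simpa using hc0)).1 key

/-- Prékopa–Leindler inequality on the line. -/
lemma prekopa_leindler_real {a b : ℝ} (ha : 0 < a) (hb : 0 < b) (hab : a + b = 1)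
    {u v h : ℝ → ℝ≥0∞} (hu : Measurable u) (hv : Measurable v) (hh : Measurable h)
    (H : ∀ x y, u x ^ a * v y ^ b ≤ h (a * x + b * y)) :
    (∫⁻ x, u x) ^ a * (∫⁻ x, v x) ^ b ≤ ∫⁻ x, h x := by
  rcases eq_or_ne (∫⁻ x, u x) 0 with hu0 | hu0
  · simp [hu0, ha]
  rcases eq_or_ne (∫⁻ x, v x) 0 with hv0 | hv0
  · simp [hv0, hb]
  have trunc : ∀ w : ℝ → ℝ≥0∞, Measurable w →
      Tendsto (fun k : ℕ => ∫⁻ x, min (w x) k) atTop (𝓝 (∫⁻ x, w x)) := by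
    intro w hw
    refine lintegral_tendsto_of_tendsto_of_monotone
      (fun k => (hw.min measurable_const).aemeasurable) (ae_of_all _ fun x k l hkl => ?_)
      (ae_of_all _ fun x => ?_)
    · exact min_le_min_left _ (by exact_mod_cast hkl)
    · simpa using (tendsto_const_nhds (x := w x)).min ENNReal.tendsto_nat_nhds_top
  have hlim := ENNReal.Tendsto.mul ((ENNReal.continuous_rpow_const (y := a)).tendsto _ |>.comp
    (trunc u hu)) (Or.inl (by simp [hu0, ha.le, ha])) ((ENNReal.continuous_rpow_const (y := b)).tendsto _
    |>.comp (trunc v hv)) (Or.inl (by simp [hv0, hb.le, hb]))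
  refine le_of_tendsto hlim (Eventually.of_forall fun k => ?_)
  have bdd : ∀ w : ℝ → ℝ≥0∞, ⨆ x, min (w x) k ≠ ∞ := fun w =>
    ((iSup_le fun x => min_le_right _ _).trans_lt (ENNReal.natCast_lt_top k)).ne
  refine prekopa_leindler_real_of_bdd ha hb hab (hu.min measurable_const)
    (hv.min measurable_const) hh (bdd u) (bdd v) fun x y => le_trans ?_ (H x y)
  gcongr <;> exact min_le_left _ _

/-- Prékopa–Leindler inequality on `Fin n → ℝ`. -/
lemma prekopa_leindler_pi {a b : ℝ} (ha : 0 < a) (hb : 0 < b) (hab : a + b = 1) (n : ℕ)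
    {u v h : (Fin n → ℝ) → ℝ≥0∞} (hu : Measurable u) (hv : Measurable v) (hh : Measurable h)
    (H : ∀ x y, u x ^ a * v y ^ b ≤ h (a • x + b • y)) :
    (∫⁻ x, u x) ^ a * (∫⁻ x, v x) ^ b ≤ ∫⁻ x, h x := by
  induction n with
  | zero =>
    simp only [lintegral_unique, volume_pi, Measure.pi_univ, Finset.univ_eq_empty, Finset.prod_empty, mul_one]
    convert H default default
  | succ n ih =>
    let e := MeasurableEquiv.piFinSuccAbove (fun _ : Fin (n + 1) => ℝ) 0
    have split : ∀ w : (Fin (n + 1) → ℝ) → ℝ≥0∞, Measurable w →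
        ∫⁻ x, w x = ∫⁻ s : ℝ, ∫⁻ z : Fin n → ℝ, w (e.symm (s, z)) := by
      intro w hw
      have hmp := (volume_preserving_piFinSuccAbove (fun _ : Fin (n + 1) => ℝ) 0).symm
      rw [← hmp.lintegral_comp hw, Measure.volume_eq_prod, lintegral_prod]
      · exact (hw.comp e.symm.measurable).aemeasurable
    rw [split u hu, split v hv, split h hh]
    have meas : ∀ w : (Fin (n + 1) → ℝ) → ℝ≥0∞, Measurable w →
        Measurable fun s : ℝ => ∫⁻ z : Fin n → ℝ, w (e.symm (s, z)) := fun w hw =>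
      (hw.comp e.symm.measurable).lintegral_prod_right'
    have sec : ∀ (w : (Fin (n + 1) → ℝ) → ℝ≥0∞) (s : ℝ), Measurable w →
        Measurable fun z : Fin n → ℝ => w (e.symm (s, z)) := fun w s hw =>
      (hw.comp e.symm.measurable).comp measurable_prodMk_left
    refine prekopa_leindler_real ha hb hab (meas u hu) (meas v hv) (meas h hh) fun s t => ?_
    refine ih (sec u s hu) (sec v t hv) (sec h _ hh) fun x y => ?_
    convert H (e.symm (s, x)) (e.symm (t, y)) using 2
    ext i
    refine Fin.cases ?_ (fun j => ?_) i <;> simp [e, MeasurableEquiv.piFinSuccAbove]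

/-- Prékopa–Leindler inequality on Euclidean space. -/
lemma prekopa_leindler {a b : ℝ} (ha : 0 < a) (hb : 0 < b) (hab : a + b = 1) (n : ℕ)
    {u v h : EuclideanSpace ℝ (Fin n) → ℝ≥0∞} (hu : Measurable u) (hv : Measurable v)
    (hh : Measurable h) (H : ∀ x y, u x ^ a * v y ^ b ≤ h (a • x + b • y)) :
    (∫⁻ x, u x) ^ a * (∫⁻ x, v x) ^ b ≤ ∫⁻ x, h x := by
  let e := (MeasurableEquiv.toLp 2 (Fin n → ℝ))
  have transfer : ∀ w : EuclideanSpace ℝ (Fin n) → ℝ≥0∞, ∫⁻ x, w (e x) = ∫⁻ x, w x := fun w =>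
    (EuclideanSpace.volume_preserving_symm_measurableEquiv_toLp (Fin n)).symm.lintegral_comp_emb
      e.measurableEmbedding w
  rw [← transfer u, ← transfer v, ← transfer h]
  exact prekopa_leindler_pi ha hb hab n (hu.comp e.measurable) (hv.comp e.measurable)
    (hh.comp e.measurable) fun x y => H _ _

end PrekopaLeindler

section SupConvolution

variable {n : ℕ}

/-- The sup-convolution of `u ^ (1 - t)` and `exp (-t ρ)` over the ball of radius `M`. -/
noncomputable def supConv (u ρ : EuclideanSpace ℝ (Fin n) → ℝ) (M t : ℝ)
    (z : EuclideanSpace ℝ (Fin n)) : ℝ :=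
  ⨆ y : Metric.closedBall (0 : EuclideanSpace ℝ (Fin n)) M,
    u (z - (t / (1 - t)) • y.1) ^ (1 - t) * exp (-(t * ρ y.1))

/-- Tangent-line bound for the geometric mean `w ^ (1 - t) * exp (-t c)`. -/
lemma rpow_mul_exp_le {w k t c : ℝ} (hw : 0 ≤ w) (hk : 0 < k) (ht0 : 0 ≤ t) (ht1 : t ≤ 1) :
    w ^ (1 - t) * exp (-(t * c)) ≤ ((1 - t) * w + t * k) * exp (-(t * (log k + c))) := by
  have h1 := geom_mean_le_arith_mean2_weighted (sub_nonneg.2 ht1) ht0 hw hk.le (by ring)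
  have h2 : exp (-(t * (log k + c))) = (k ^ t)⁻¹ * exp (-(t * c)) := by
    rw [rpow_def_of_pos hk, ← exp_neg, ← exp_add]
    ring_nf
  have hkt : 0 < k ^ t := rpow_pos_of_pos hk t
  rw [h2, ← mul_assoc]
  gcongr
  rwa [← div_eq_mul_inv, le_div_iff₀ hkt]

variable {u ρ : EuclideanSpace ℝ (Fin n) → ℝ} {M t : ℝ}

lemma rpow_mul_exp_le_add {L : NNReal} (hu : LipschitzWith L u) (hu0 : ∀ x, 0 ≤ u x)
    (hρ0 : ∀ y, 0 ≤ ρ y) (ht0 : 0 < t) (ht : t ≤ 1 / 2) (z : EuclideanSpace ℝ (Fin n))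
    {y : EuclideanSpace ℝ (Fin n)} (hy : ‖y‖ ≤ M) :
    u (z - (t / (1 - t)) • y) ^ (1 - t) * exp (-(t * ρ y)) ≤ u z + t * (1 + L * M) := by
  have h1t : 0 < 1 - t := by linarith
  have hM : 0 ≤ M := (norm_nonneg y).trans hy
  set x := z - (t / (1 - t)) • y with hx
  have hdist : |u x - u z| ≤ L * (t / (1 - t) * M) := by
    have := hu.dist_le_mul x z
    rw [Real.dist_eq, dist_eq_norm, hx, sub_sub_cancel_left, norm_neg, norm_smul,
      Real.norm_of_nonneg (by positivity)] at this
    exact this.trans (by gcongr)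
  have hux : (1 - t) * u x ≤ u z + t * (L * M) := by
    have h2 : (1 - t) * (u x - u z) ≤ (1 - t) * (L * (t / (1 - t) * M)) := by
      gcongr
      exact (le_abs_self _).trans hdist
    have h3 : (1 - t) * (L * (t / (1 - t) * M)) = t * (L * M) := by field_simp
    nlinarith [mul_nonneg ht0.le (hu0 z)]
  have h4 := rpow_mul_exp_le (c := ρ y) (hu0 x) one_pos ht0.le (by linarith)
  have h5 : exp (-(t * (log 1 + ρ y))) ≤ 1 := by
    rw [exp_le_one_iff, log_one, zero_add]
    nlinarith [mul_nonneg ht0.le (hρ0 y)]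
  have h6 : 0 ≤ (1 - t) * u x + t * 1 := by nlinarith [mul_nonneg h1t.le (hu0 x)]
  nlinarith [mul_le_mul_of_nonneg_left h5 h6]

lemma bddAbove_supConv {L : NNReal} (hu : LipschitzWith L u) (hu0 : ∀ x, 0 ≤ u x)
    (hρ0 : ∀ y, 0 ≤ ρ y) (ht0 : 0 < t) (ht : t ≤ 1 / 2) (z : EuclideanSpace ℝ (Fin n)) :
    BddAbove (Set.range fun y : Metric.closedBall (0 : EuclideanSpace ℝ (Fin n)) M =>
      u (z - (t / (1 - t)) • y.1) ^ (1 - t) * exp (-(t * ρ y.1))) := by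
  refine ⟨u z + t * (1 + L * M), ?_⟩
  rintro _ ⟨y, rfl⟩
  exact rpow_mul_exp_le_add hu hu0 hρ0 ht0 ht z (mem_closedBall_zero_iff.1 y.2)

lemma supConv_nonneg (hu0 : ∀ x, 0 ≤ u x) (z : EuclideanSpace ℝ (Fin n)) :
    0 ≤ supConv u ρ M t z :=
  Real.iSup_nonneg fun _ => mul_nonneg (rpow_nonneg (hu0 _) _) (exp_pos _).le

lemma supConv_le {L : NNReal} (hu : LipschitzWith L u) (hu0 : ∀ x, 0 ≤ u x)
    (hρ0 : ∀ y, 0 ≤ ρ y) (hM : 0 ≤ M) (ht0 : 0 < t) (ht : t ≤ 1 / 2)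
    (z : EuclideanSpace ℝ (Fin n)) :
    supConv u ρ M t z ≤ u z + t * (1 + L * M) := by
  have : Nonempty (Metric.closedBall (0 : EuclideanSpace ℝ (Fin n)) M) :=
    ⟨⟨0, by simpa using hM⟩⟩
  exact ciSup_le fun y => rpow_mul_exp_le_add hu hu0 hρ0 ht0 ht z (mem_closedBall_zero_iff.1 y.2)

lemma measurable_supConv {L : NNReal} (hu : LipschitzWith L u) (hu0 : ∀ x, 0 ≤ u x)
    (hρ0 : ∀ y, 0 ≤ ρ y) (ht0 : 0 < t) (ht : t ≤ 1 / 2) :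
    Measurable (supConv u ρ M t) := by
  refine LowerSemicontinuous.measurable ?_
  refine lowerSemicontinuous_ciSup (fun z => bddAbove_supConv hu hu0 hρ0 ht0 ht z) fun y => ?_
  refine Continuous.lowerSemicontinuous ?_
  have h1 : 0 ≤ 1 - t := by linarith
  exact ((hu.continuous.comp (by fun_prop)).rpow_const fun _ => Or.inr h1).mul_const _

lemma supConv_eq_zero (ht0 : 0 < t) (ht : t ≤ 1 / 2) {z : EuclideanSpace ℝ (Fin n)}
    (hz : z ∉ Metric.cthickening M (tsupport u)) : supConv u ρ M t z = 0 := by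
  have h1t : 0 < 1 - t := by linarith
  have hs : t / (1 - t) ≤ 1 := by rw [div_le_one h1t]; linarith
  have : ∀ y : Metric.closedBall (0 : EuclideanSpace ℝ (Fin n)) M,
      u (z - (t / (1 - t)) • y.1) ^ (1 - t) * exp (-(t * ρ y.1)) = 0 := by
    rintro ⟨y, hy⟩
    have hy : ‖y‖ ≤ M := by simpa using hy
    have hux : u (z - (t / (1 - t)) • y) = 0 := by
      by_contra hne
      refine hz (Metric.mem_cthickening_of_dist_le z _ M _ (subset_tsupport u hne) ?_)
      rw [dist_eq_norm, sub_sub_cancel, norm_smul, Real.norm_of_nonneg (by positivity)]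
      nlinarith [norm_nonneg y]
    simp [hux, zero_rpow h1t.ne']
  simp [supConv, this]

lemma supConv_sub_le_indicator {L : NNReal} (hu : LipschitzWith L u) (hu0 : ∀ x, 0 ≤ u x)
    (hρ0 : ∀ y, 0 ≤ ρ y) (hM : 0 ≤ M) (ht0 : 0 < t) (ht : t ≤ 1 / 2)
    (z : EuclideanSpace ℝ (Fin n)) :
    (supConv u ρ M t z - u z) / t ≤
      (Metric.cthickening M (tsupport u)).indicator (fun _ => 1 + L * M) z := by
  by_cases hz : z ∈ Metric.cthickening M (tsupport u)
  · rw [Set.indicator_of_mem hz, div_le_iff₀ ht0]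
    linarith [supConv_le hu hu0 hρ0 hM ht0 ht z]
  · rw [Set.indicator_of_notMem hz, supConv_eq_zero ht0 ht hz]
    exact div_nonpos_of_nonpos_of_nonneg (by linarith [hu0 z]) ht0.le

lemma integrable_supConv {L : NNReal} (hu : LipschitzWith L u) (hu0 : ∀ x, 0 ≤ u x)
    (hsupp : HasCompactSupport u) (hρ0 : ∀ y, 0 ≤ ρ y) (hM : 0 ≤ M) (ht0 : 0 < t)
    (ht : t ≤ 1 / 2) : Integrable (supConv u ρ M t) := by
  have hK : IsCompact (Metric.cthickening M (tsupport u)) := IsCompact.cthickening hsupp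
  have hbd : Integrable fun z => u z +
      t * (Metric.cthickening M (tsupport u)).indicator (fun _ => 1 + L * M) z :=
    (hu.continuous.integrable_of_hasCompactSupport hsupp).add
      (((integrable_indicator_iff hK.measurableSet).2
        (integrableOn_const hK.measure_lt_top.ne)).const_mul t)
  refine hbd.mono' (measurable_supConv hu hu0 hρ0 ht0 ht).aestronglyMeasurable
    (ae_of_all _ fun z => ?_)
  rw [Real.norm_of_nonneg (supConv_nonneg hu0 z)]
  have := supConv_sub_le_indicator hu hu0 hρ0 hM ht0 ht z
  rw [div_le_iff₀ ht0] at this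
  linarith

/-- Prékopa–Leindler inequality for the sup-convolution. -/
lemma rpow_setIntegral_exp_le {L : NNReal} (hu : LipschitzWith L u) (hu0 : ∀ x, 0 ≤ u x)
    (hsupp : HasCompactSupport u) (hint : ∫ x, u x = 1) (hρ : Continuous ρ)
    (hρ0 : ∀ y, 0 ≤ ρ y) (hM : 0 ≤ M) (ht0 : 0 < t) (ht : t ≤ 1 / 2) :
    (∫ y in Metric.closedBall (0 : EuclideanSpace ℝ (Fin n)) M, exp (-ρ y)) ^ t ≤
      (1 - t) ^ n * ∫ z, supConv u ρ M t z := by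
  have h1t : 0 < 1 - t := by linarith
  set S := Metric.closedBall (0 : EuclideanSpace ℝ (Fin n)) M with hS
  have hSm : MeasurableSet S := Metric.isClosed_closedBall.measurableSet
  have hH := integrable_supConv (t := t) hu hu0 hsupp hρ0 hM ht0 ht
  have key := prekopa_leindler h1t ht0 (by ring) n
    (u := fun x => ENNReal.ofReal (u x))
    (v := S.indicator fun y => ENNReal.ofReal (exp (-ρ y)))
    (h := fun w => ENNReal.ofReal (supConv u ρ M t ((1 - t)⁻¹ • w)))
    hu.continuous.measurable.ennreal_ofReal
    (Measurable.indicator (by fun_prop) hSm)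
    ((measurable_supConv hu hu0 hρ0 ht0 ht).comp (measurable_const_smul _)).ennreal_ofReal
    (by
      intro x y
      by_cases hy : y ∈ S
      · rw [Set.indicator_of_mem hy, ENNReal.ofReal_rpow_of_nonneg (hu0 x) h1t.le,
          ENNReal.ofReal_rpow_of_nonneg (exp_pos _).le ht0.le,
          ← ENNReal.ofReal_mul (rpow_nonneg (hu0 x) _)]
        refine ENNReal.ofReal_le_ofReal ?_
        refine le_trans (le_of_eq ?_) (le_ciSup (bddAbove_supConv hu hu0 hρ0 ht0 ht _) ⟨y, hy⟩)
        simp only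
        congr 2
        · rw [smul_add, smul_smul, smul_smul, inv_mul_cancel₀ h1t.ne', one_smul,
            inv_mul_eq_div, add_sub_cancel_right]
        · rw [← exp_mul]
          ring_nf
      · rw [Set.indicator_of_notMem hy]
        simp [ht0])
  have hexp : IntegrableOn (fun y => exp (-ρ y)) S :=
    (by fun_prop : Continuous fun y => exp (-ρ y)).continuousOn.integrableOn_compact
      (isCompact_closedBall _ _)
  rw [lintegral_indicator hSm, ← ofReal_integral_eq_lintegral_ofReal
      (hu.continuous.integrable_of_hasCompactSupport hsupp) (ae_of_all _ hu0), hint,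
    ← ofReal_integral_eq_lintegral_ofReal hexp (ae_of_all _ fun y => (exp_pos _).le),
    ← ofReal_integral_eq_lintegral_ofReal (hH.comp_smul (inv_ne_zero h1t.ne'))
      (ae_of_all _ fun w => supConv_nonneg hu0 _), ENNReal.ofReal_one, ENNReal.one_rpow, one_mul,
    ENNReal.ofReal_rpow_of_nonneg (integral_nonneg fun y => (exp_pos _).le) ht0.le,
    ENNReal.ofReal_le_ofReal_iff (integral_nonneg fun w => supConv_nonneg hu0 _),
    Measure.integral_comp_smul] at key
  simpa [abs_of_pos h1t] using key

end SupConvolution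

section Derivative

lemma mul_exp_le_add_sq {P u₀ d κ t R D : ℝ} (hP : 0 ≤ P) (hPu : P ≤ u₀ + t * d)
    (hκ : |κ| ≤ R) (hd : |d| ≤ D) (ht0 : 0 < t) (ht1 : t ≤ 1) (htR : t * R ≤ 1) :
    P * exp (-(t * κ)) ≤ u₀ + t * (d - u₀ * κ) + t ^ 2 * (D * R + D * R ^ 2 + u₀ * R ^ 2) := by
  have hR : 0 ≤ R := (abs_nonneg κ).trans hκ
  have hD : 0 ≤ D := (abs_nonneg d).trans hd
  have habs : |-(t * κ)| ≤ t * R := by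
    rw [abs_neg, abs_mul, abs_of_pos ht0]
    gcongr
  have hexp := (abs_le.1 (abs_exp_sub_one_sub_id_le (habs.trans htR))).2
  have hsq : (-(t * κ)) ^ 2 ≤ (t * R) ^ 2 := sq_le_sq' (by linarith [neg_le_of_abs_le habs])
    (le_of_abs_le habs)
  have hA : exp (-(t * κ)) ≤ 1 - t * κ + t ^ 2 * R ^ 2 := by nlinarith
  have hA0 : 0 ≤ 1 - t * κ + t ^ 2 * R ^ 2 := (exp_pos _).le.trans hA
  have hdκ : -(d * κ) ≤ D * R := by
    refine (neg_le_abs _).trans ?_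
    rw [abs_mul]
    gcongr
  have hdR : t * d * R ^ 2 ≤ D * R ^ 2 := by
    have : t * d ≤ D := by nlinarith [le_of_abs_le hd]
    gcongr
  calc P * exp (-(t * κ)) ≤ (u₀ + t * d) * (1 - t * κ + t ^ 2 * R ^ 2) := by gcongr; linarith
    _ = u₀ + t * (d - u₀ * κ) + t ^ 2 * (-(d * κ) + t * d * R ^ 2 + u₀ * R ^ 2) := by ring
    _ ≤ _ := by gcongr

variable {n : ℕ} {u ρ : EuclideanSpace ℝ (Fin n) → ℝ} {M : ℝ}

lemma eventually_supConv_le (hu0 : ∀ x, 0 ≤ u x) (hρ : Continuous ρ) (hM : 0 ≤ M)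
    {z : EuclideanSpace ℝ (Fin n)} (hdiff : DifferentiableAt ℝ u z) {g : ℝ}
    (hg : ∀ y, -(fderiv ℝ u z y) ≤ u z * ρ y + g) {k ε : ℝ} (hk : 0 < k) (hε : 0 < ε) :
    ∀ᶠ t in 𝓝[>] (0 : ℝ), (supConv u ρ M t z - u z) / t ≤
      g + (k - u z - u z * log k) + ε := by
  have : Nonempty (Metric.closedBall (0 : EuclideanSpace ℝ (Fin n)) M) :=
    ⟨⟨0, by simpa using hM⟩⟩
  obtain ⟨R₀, hR₀⟩ := (isCompact_closedBall (0 : EuclideanSpace ℝ (Fin n)) M).exists_bound_of_continuousOn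
    hρ.continuousOn
  set R := |log k| + R₀ with hR
  set D := ‖fderiv ℝ u z‖ * M + u z + k + ε / 2 with hD
  set C := D * R + D * R ^ 2 + u z * R ^ 2 with hC
  have hε1 : 0 < ε / (2 * (M + 1)) := by positivity
  obtain ⟨δ, hδ, hball⟩ := Metric.eventually_nhds_iff.1 (hdiff.hasFDerivAt.isLittleO.def hε1)
  have small : ∀ c b : ℝ, 0 < b → ∀ᶠ t in 𝓝[>] (0 : ℝ), t * c < b := by
    intro c b hb
    have : Tendsto (fun t : ℝ => t * c) (𝓝[>] 0) (𝓝 0) := by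
      have := (tendsto_id (α := ℝ) (x := 𝓝 0)).mul_const c
      simp only [id, zero_mul] at this
      exact this.mono_left nhdsWithin_le_nhds
    exact this.eventually_lt_const hb
  filter_upwards [self_mem_nhdsWithin, small 2 1 one_pos, small (2 * M) δ hδ, small R 1 one_pos,
    small C (ε / 2) (by positivity)] with t ht0 ht hδt htR htC
  have ht0 : 0 < t := ht0
  have h1t : 0 < 1 - t := by linarith
  rw [div_le_iff₀ ht0, sub_le_iff_le_add]
  refine ciSup_le fun ⟨y, hy⟩ => ?_
  have hρy := hR₀ y hy
  have hy : ‖y‖ ≤ M := mem_closedBall_zero_iff.1 hy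
  simp only
  set x := z - (t / (1 - t)) • y with hx
  have hxz : x - z = -((t / (1 - t)) • y) := by rw [hx]; abel
  have hnorm : ‖x - z‖ ≤ t / (1 - t) * M := by
    rw [hxz, norm_neg, norm_smul, Real.norm_of_nonneg (by positivity)]
    gcongr
  have hts : t / (1 - t) ≤ t * 2 := by
    rw [div_le_iff₀ h1t]; nlinarith
  have hclose : dist x z < δ := by
    rw [dist_eq_norm]
    nlinarith
  have hlin := hball hclose
  rw [Real.norm_eq_abs] at hlin
  have hlin := (le_abs_self _).trans hlin
  rw [hxz, map_neg, map_smul, smul_eq_mul, ← hxz] at hlin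
  have hP0 : 0 ≤ (1 - t) * u x + t * k := by
    have := hu0 x
    positivity
  set d := -(fderiv ℝ u z y) - u z + k + ε / 2 with hd
  have hP : (1 - t) * u x + t * k ≤ u z + t * d := by
    have h1 : (1 - t) * (u x - u z - -(t / (1 - t) * fderiv ℝ u z y)) ≤
        (1 - t) * (ε / (2 * (M + 1)) * (t / (1 - t) * M)) := by
      gcongr
      exact hlin.trans (by gcongr)
    have h2 : (1 - t) * (u x - u z - -(t / (1 - t) * fderiv ℝ u z y)) =
        (1 - t) * (u x - u z) + t * fderiv ℝ u z y := by field_simp; ring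
    have h3 : (1 - t) * (ε / (2 * (M + 1)) * (t / (1 - t) * M)) = t * (ε / 2 * (M / (M + 1))) := by
      field_simp
    have h4 : M / (M + 1) ≤ 1 := by rw [div_le_one (by linarith)]; linarith
    have h5 : t * (ε / 2 * (M / (M + 1))) ≤ t * (ε / 2 * 1) := by gcongr
    rw [hd]
    linarith
  have hκ : |log k + ρ y| ≤ R := (abs_add_le _ _).trans (by
    rw [hR]; gcongr; exact hρy)
  have hdD : |d| ≤ D := by
    have h1 : |fderiv ℝ u z y| ≤ ‖fderiv ℝ u z‖ * M := by
      refine ((fderiv ℝ u z).le_opNorm y).trans ?_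
      gcongr
    have h2 := abs_le.1 h1
    have h3 := hu0 z
    rw [hd, hD, abs_le]
    constructor <;> linarith
  refine (rpow_mul_exp_le (hu0 x) hk ht0.le (by linarith)).trans ?_
  refine (mul_exp_le_add_sq hP0 hP hκ hdD ht0 (by linarith) htR.le).trans ?_
  rw [← hC]
  have h1 : d - u z * (log k + ρ y) ≤ g + (k - u z - u z * log k) + ε / 2 := by
    rw [hd]
    linarith [hg y]
  nlinarith [mul_le_mul_of_nonneg_left h1 ht0.le, mul_le_mul_of_nonneg_left htC.le ht0.le]

lemma eventually_supConv_sub_div_le (hu0 : ∀ x, 0 ≤ u x) (hρ : Continuous ρ) (hM : 0 ≤ M)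
    {z : EuclideanSpace ℝ (Fin n)} (hdiff : DifferentiableAt ℝ u z) {g : ℝ}
    (hg : ∀ y, -(fderiv ℝ u z y) ≤ u z * ρ y + g) {ε : ℝ} (hε : 0 < ε) :
    ∀ᶠ t in 𝓝[>] (0 : ℝ), (supConv u ρ M t z - u z) / t ≤ g - u z * log (u z) + ε := by
  rcases (hu0 z).eq_or_lt' with hz | hz
  · filter_upwards [eventually_supConv_le hu0 hρ hM hdiff hg (half_pos hε) (half_pos hε)]
      with t ht
    rw [hz] at ht ⊢
    linarith
  · filter_upwards [eventually_supConv_le hu0 hρ hM hdiff hg hz hε] with t ht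
    linarith

lemma log_setIntegral_exp_le (hu : ContDiff ℝ 1 u) (hu0 : ∀ x, 0 ≤ u x)
    (hsupp : HasCompactSupport u) (hint : ∫ x, u x = 1) (hρ : Continuous ρ)
    (hρ0 : ∀ y, 0 ≤ ρ y) (hM : 0 < M) {g : EuclideanSpace ℝ (Fin n) → ℝ} (hgi : Integrable g)
    (hg : ∀ z y, -(fderiv ℝ u z y) ≤ u z * ρ y + g z) :
    log (∫ y in Metric.closedBall (0 : EuclideanSpace ℝ (Fin n)) M, exp (-ρ y)) ≤
      -n + ((∫ z, g z) - ∫ z, u z * log (u z)) := by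
  obtain ⟨L, hL⟩ := hu.lipschitzWith_of_hasCompactSupport hsupp one_ne_zero
  have hui : Integrable u := hu.continuous.integrable_of_hasCompactSupport hsupp
  have hent : Integrable fun z => u z * log (u z) := by
    refine (Real.continuous_mul_log.comp hu.continuous).integrable_of_hasCompactSupport ?_
    exact hsupp.comp_left (g := fun x => x * log x) (by simp)
  set S := Metric.closedBall (0 : EuclideanSpace ℝ (Fin n)) M with hS
  set Z := ∫ y in S, exp (-ρ y) with hZ
  have hexp : IntegrableOn (fun y => exp (-ρ y)) S :=
    (by fun_prop : Continuous fun y => exp (-ρ y)).continuousOn.integrableOn_compact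
      (isCompact_closedBall _ _)
  have hZ0 : 0 < Z := by
    rw [hZ, setIntegral_pos_iff_support_of_nonneg_ae (ae_of_all _ fun y => (exp_pos _).le) hexp]
    have : (Function.support fun y => exp (-ρ y)) = Set.univ :=
      Set.eq_univ_of_forall fun y => (exp_pos _).ne'
    rw [this, Set.univ_inter]
    exact Metric.measure_closedBall_pos _ _ hM
  set w := fun z => g z - u z * log (u z) with hw
  have hwi : Integrable w := hgi.sub hent
  rw [← integral_sub hgi hent]
  set B := (Metric.cthickening M (tsupport u)).indicator
    (fun _ : EuclideanSpace ℝ (Fin n) => 1 + L * M) with hB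
  have hK : IsCompact (Metric.cthickening M (tsupport u)) := IsCompact.cthickening hsupp
  have hBi : Integrable B := (integrable_indicator_iff hK.measurableSet).2
        (integrableOn_const hK.measure_lt_top.ne)
  have hB0 : ∀ z, 0 ≤ B z := fun z => Set.indicator_nonneg (fun _ _ => by positivity) z
  set q := fun (t : ℝ) z => (supConv u ρ M t z - u z) / t with hq
  have hsmall : ∀ᶠ t in 𝓝[>] (0 : ℝ), 0 < t ∧ t ≤ 1 / 2 := by
    filter_upwards [Ioc_mem_nhdsGT (show (0 : ℝ) < 1 / 2 by norm_num)] with t ht using ht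
  have hkbound : ∀ t, 0 < t ∧ t ≤ 1 / 2 → ∀ z, ‖max (q t z) (w z)‖ ≤ B z + |w z| := by
    intro t ht z
    rw [Real.norm_eq_abs, abs_le]
    constructor
    · linarith [le_max_right (q t z) (w z), neg_abs_le (w z), hB0 z]
    · refine max_le ?_ (by linarith [le_abs_self (w z), hB0 z])
      have := supConv_sub_le_indicator hL hu0 hρ0 hM.le ht.1 ht.2 z
      exact this.trans (le_add_of_nonneg_right (abs_nonneg _))
  have hqm : ∀ t, 0 < t ∧ t ≤ 1 / 2 → Measurable (q t) := fun t ht =>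
    ((measurable_supConv hL hu0 hρ0 ht.1 ht.2).sub hu.continuous.measurable).div_const t
  have hlim : Tendsto (fun t => ∫ z, max (q t z) (w z)) (𝓝[>] 0) (𝓝 (∫ z, w z)) := by
    refine tendsto_integral_filter_of_dominated_convergence (fun z => B z + |w z|) ?_ ?_
      (hBi.add hwi.abs) (ae_of_all _ fun z => ?_)
    · filter_upwards [hsmall] with t ht
      exact (hqm t ht).aestronglyMeasurable.sup hwi.aestronglyMeasurable
    · filter_upwards [hsmall] with t ht
      exact ae_of_all _ (hkbound t ht)
    · rw [Metric.tendsto_nhds]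
      intro ε hε
      filter_upwards [eventually_supConv_sub_div_le (M := M) hu0 hρ hM.le
        (hu.differentiable one_ne_zero z) (hg z) (half_pos hε)] with t ht
      rw [Real.dist_eq, abs_of_nonneg (sub_nonneg.2 (le_max_right _ _)), sub_lt_iff_lt_add]
      refine max_lt ?_ (by linarith)
      simp only [hq, hw]
      linarith
  refine ge_of_tendsto (hlim.const_add (-(n : ℝ))) ?_
  filter_upwards [hsmall] with t ht
  have h1t : 0 < 1 - t := by linarith [ht.2]
  have hpl := rpow_setIntegral_exp_le hL hu0 hsupp hint hρ hρ0 hM.le ht.1 ht.2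
  have hHi := integrable_supConv hL hu0 hsupp hρ0 hM.le ht.1 ht.2
  have hmi : Integrable fun z => max (q t z) (w z) :=
    (hBi.add hwi.abs).mono' ((hqm t ht).aestronglyMeasurable.sup hwi.aestronglyMeasurable)
      (ae_of_all _ (hkbound t ht))
  have hle : ∫ z, supConv u ρ M t z ≤ 1 + t * ∫ z, max (q t z) (w z) := by
    rw [← hint, ← integral_const_mul, ← integral_add hui (hmi.const_mul t)]
    refine integral_mono hHi (hui.add (hmi.const_mul t)) fun z => ?_
    have h1 : t * q t z ≤ t * max (q t z) (w z) := by
      gcongr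
      exacts [ht.1.le, le_max_left _ _]
    have h2 : t * q t z = supConv u ρ M t z - u z := mul_div_cancel₀ _ ht.1.ne'
    linarith
  have hpl := hpl.trans (mul_le_mul_of_nonneg_left hle (pow_nonneg h1t.le n))
  have hpos : 0 < (1 - t) ^ n * (1 + t * ∫ z, max (q t z) (w z)) :=
    (rpow_pos_of_pos hZ0 t).trans_le hpl
  have hpos2 : 0 < 1 + t * ∫ z, max (q t z) (w z) := pos_of_mul_pos_right hpos (pow_nonneg h1t.le n)
  have hlog := log_le_log (rpow_pos_of_pos hZ0 t) hpl
  rw [log_rpow hZ0, log_mul (pow_pos h1t n).ne' hpos2.ne', log_pow] at hlog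
  have h3 := log_le_sub_one_of_pos hpos2
  have h4 := mul_le_mul_of_nonneg_left (log_le_sub_one_of_pos h1t) (Nat.cast_nonneg (α := ℝ) n)
  have h5 : t * log Z ≤ t * (-n + ∫ z, max (q t z) (w z)) := by linarith
  exact le_of_mul_le_mul_left h5 ht.1

/-- Linearized logarithmic Sobolev inequality. -/
lemma log_integral_exp_le (hu : ContDiff ℝ 1 u) (hu0 : ∀ x, 0 ≤ u x)
    (hsupp : HasCompactSupport u) (hint : ∫ x, u x = 1) (hρ : Continuous ρ)
    (hρ0 : ∀ y, 0 ≤ ρ y) (hρi : Integrable fun y => exp (-ρ y))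
    {g : EuclideanSpace ℝ (Fin n) → ℝ} (hgi : Integrable g)
    (hg : ∀ z y, -(fderiv ℝ u z y) ≤ u z * ρ y + g z) :
    log (∫ y, exp (-ρ y)) ≤ -n + ((∫ z, g z) - ∫ z, u z * log (u z)) := by
  have hpos : 0 < ∫ y, exp (-ρ y) := integral_exp_pos hρi
  have hcov : AECover volume atTop fun k : ℕ =>
      Metric.closedBall (0 : EuclideanSpace ℝ (Fin n)) (k : ℝ) :=
    aecover_closedBall tendsto_natCast_atTop_atTop
  have hlim := ((continuousAt_log hpos.ne').tendsto).comp
    (hcov.integral_tendsto_of_countably_generated hρi)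
  refine le_of_tendsto hlim ?_
  filter_upwards [eventually_gt_atTop 0] with k hk
  exact log_setIntegral_exp_le hu hu0 hsupp hint hρ hρ0 (by exact_mod_cast hk) hgi hg

end Derivative

section LogSobolev

lemma mul_le_rpow_conjExponent_add {p a b : ℝ} (hp : 1 < p) (ha : 0 ≤ a) (hb : 0 ≤ b) :
    p * (a * b) ≤ a ^ (p / (p - 1)) + (p - 1) ^ (p - 1) * b ^ p := by
  have hp0 : 0 < p - 1 := by linarith
  have hpq : (p / (p - 1)).HolderConjugate p := (Real.HolderConjugate.conjExponent hp).symm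
  have h := young_inequality_of_nonneg ha (mul_nonneg hp0.le hb) hpq
  have h2 : (p - 1) ^ p = (p - 1) ^ (p - 1) * (p - 1) := by
    rw [← rpow_add_one hp0.ne', sub_add_cancel]
  rw [mul_rpow hp0.le hb, h2] at h
  have h3 : p / (p - 1) * (a * ((p - 1) * b)) ≤ p / (p - 1) * (a ^ (p / (p - 1)) / (p / (p - 1)) +
      (p - 1) ^ (p - 1) * (p - 1) * b ^ p / p) := by gcongr
  have hp1 : p ≠ 0 := by linarith
  field_simp at h3 ⊢
  linarith

lemma ballVol_pos (n : ℕ) : 0 < ballVol n :=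
  div_pos (rpow_pos_of_pos pi_pos _) (Gamma_pos_of_pos (by positivity))

lemma integral_exp_neg_norm_rpow {n : ℕ} (hn : n ≠ 0) {q : ℝ} (hq : 0 < q) :
    ∫ y : EuclideanSpace ℝ (Fin n), exp (-‖y‖ ^ q) = ballVol n * Gamma (n / q + 1) := by
  have : Nonempty (Fin n) := Fin.pos_iff_nonempty.1 (Nat.pos_of_ne_zero hn)
  have h := measure_unitBall_eq_integral_div_gamma
    (volume : Measure (EuclideanSpace ℝ (Fin n))) hq
  have hΓ : 0 < Gamma (n / q + 1) := Gamma_pos_of_pos (by positivity)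
  rw [EuclideanSpace.volume_ball, ENNReal.ofReal_one, one_pow, one_mul, Fintype.card_fin,
    finrank_euclideanSpace_fin, ENNReal.ofReal_eq_ofReal_iff] at h
  · rw [eq_div_iff hΓ.ne'] at h
    rw [← h, ballVol, sqrt_eq_rpow, ← rpow_natCast, ← rpow_mul pi_pos.le]
    ring_nf
  · exact div_nonneg (by positivity) (Gamma_pos_of_pos (by positivity)).le
  · exact div_nonneg (integral_nonneg fun _ => (exp_pos _).le) hΓ.le

lemma abs_rpow_entropy_le {n : ℕ} (hn : n ≠ 0) {p : ℝ} (hp : 1 < p)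
    {f : EuclideanSpace ℝ (Fin n) → ℝ} (hf : ContDiff ℝ 1 f) (hsupp : HasCompactSupport f)
    (hnorm : ∫ x, |f x| ^ p = 1) {l : ℝ} (hl : 0 < l) :
    ∫ x, |f x| ^ p * log (|f x| ^ p) ≤
      (p - 1) ^ (p - 1) * l ^ (-p) * (∫ x, ‖fderiv ℝ f x‖ ^ p) - n
        - log (ballVol n * Gamma (n / (p / (p - 1)) + 1)) + n * log l := by
  have hp0 : 0 < p := by linarith
  have hp1 : 0 < p - 1 := by linarith
  set q := p / (p - 1) with hq
  have hq0 : 0 < q := div_pos hp0 hp1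
  set Z := ballVol n * Gamma (n / q + 1) with hZ
  have hZ0 : 0 < Z := mul_pos (ballVol_pos n) (Gamma_pos_of_pos (by positivity))
  have hZi : ∫ y : EuclideanSpace ℝ (Fin n), exp (-‖y‖ ^ q) = Z :=
    integral_exp_neg_norm_rpow hn hq0
  have hint : Integrable fun y : EuclideanSpace ℝ (Fin n) => exp (-‖y‖ ^ q) :=
    not_imp_comm.1 integral_undef (hZi ▸ hZ0.ne')
  have hnrm : ∀ y : EuclideanSpace ℝ (Fin n), ‖l • y‖ = l * ‖y‖ := fun y => by
    rw [norm_smul, Real.norm_of_nonneg hl.le]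
  have hint' := hint.comp_smul hl.ne'
  have hZl := Measure.integral_comp_smul (volume : Measure (EuclideanSpace ℝ (Fin n)))
    (fun y => exp (-‖y‖ ^ q)) l
  simp only [hnrm] at hint' hZl
  rw [hZi, finrank_euclideanSpace_fin, abs_of_pos (by positivity), smul_eq_mul] at hZl
  have hsupp' : HasCompactSupport fun x => |f x| ^ p :=
    hsupp.comp_left (g := fun a => |a| ^ p) (by simp [hp0.ne'])
  have hgi : Integrable fun z => (p - 1) ^ (p - 1) * l ^ (-p) * ‖fderiv ℝ f z‖ ^ p := by
    refine Integrable.const_mul (Continuous.integrable_of_hasCompactSupport ?_ ?_) _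
    · exact (hf.continuous_fderiv one_ne_zero).norm.rpow_const fun _ => Or.inr hp0.le
    · exact (hsupp.fderiv ℝ).comp_left (g := fun a => ‖a‖ ^ p) (by simp [hp0.ne'])
  have key := log_integral_exp_le (u := fun x => |f x| ^ p) (ρ := fun y => (l * ‖y‖) ^ q)
    (g := fun z => (p - 1) ^ (p - 1) * l ^ (-p) * ‖fderiv ℝ f z‖ ^ p)
    (hf.norm_rpow hp) (fun x => by positivity) hsupp' hnorm
    ((by fun_prop : Continuous fun y : EuclideanSpace ℝ (Fin n) => l * ‖y‖).rpow_const
      fun _ => Or.inr hq0.le) (fun y => by positivity) hint' hgi (by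
      intro z y
      have h1 := norm_fderiv_norm_rpow_le (hf.differentiable one_ne_zero) (x := z) hp
      simp only [Real.norm_eq_abs] at h1
      have h2 := mul_le_rpow_conjExponent_add hp (a := |f z| ^ (p - 1) * (l * ‖y‖))
        (b := ‖fderiv ℝ f z‖ / l) (by positivity) (by positivity)
      have h3 : (|f z| ^ (p - 1) * (l * ‖y‖)) ^ (p / (p - 1)) = |f z| ^ p * (l * ‖y‖) ^ q := by
        rw [mul_rpow (by positivity) (by positivity), ← rpow_mul (abs_nonneg _),
          mul_div_cancel₀ _ hp1.ne']
      have h4 : (‖fderiv ℝ f z‖ / l) ^ p = l ^ (-p) * ‖fderiv ℝ f z‖ ^ p := by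
        rw [div_rpow (norm_nonneg _) hl.le, rpow_neg hl.le]
        ring
      have h5 : p * (|f z| ^ (p - 1) * (l * ‖y‖) * (‖fderiv ℝ f z‖ / l)) =
          p * |f z| ^ (p - 1) * ‖fderiv ℝ f z‖ * ‖y‖ := by field_simp
      rw [h3, h4, h5, ← mul_assoc] at h2
      refine le_trans ?_ h2
      refine (neg_le_abs _).trans (((fderiv ℝ (fun x => |f x| ^ p) z).le_opNorm y).trans ?_)
      gcongr)
  rw [hZl, log_mul (by positivity) hZ0.ne', log_inv, log_pow, integral_const_mul] at key
  linarith

end LogSobolev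

/-- Sharp `L^p`-logarithmic Sobolev inequality in `ℝ^n` (Euclidean case of Theorem 1.2). -/
theorem sharp_Lp_log_sobolev_euclidean (n : ℕ) (hn : 2 ≤ n) (p : ℝ) (hp : 1 < p)
    (f : EuclideanSpace ℝ (Fin n) → ℝ) (hf : ContDiff ℝ (⊤ : ℕ∞) f)
    (hsupp : HasCompactSupport f)
    (hnorm : ∫ x : EuclideanSpace ℝ (Fin n), |f x| ^ p = 1) :
    ∫ x : EuclideanSpace ℝ (Fin n), |f x| ^ p * Real.log (|f x| ^ p) ≤
      ((n : ℝ) / p) * Real.log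
        (Lconst n p * ∫ x : EuclideanSpace ℝ (Fin n), ‖fderiv ℝ f x‖ ^ p) := by
  have hn0 : n ≠ 0 := by omega
  have hnpos : (0 : ℝ) < n := by exact_mod_cast Nat.pos_of_ne_zero hn0
  have hp0 : 0 < p := by linarith
  have hp1 : 0 < p - 1 := by linarith
  have key := fun l hl => abs_rpow_entropy_le hn0 hp (hf.of_le (by exact_mod_cast le_top)) hsupp
    hnorm (l := l) hl
  set Z := ballVol n * Gamma (n / (p / (p - 1)) + 1) with hZ
  have hZ0 : 0 < Z := mul_pos (ballVol_pos n) (Gamma_pos_of_pos (by positivity))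
  set G := ∫ x, ‖fderiv ℝ f x‖ ^ p with hG
  set c := (p - 1) ^ (p - 1) with hc
  have hc0 : 0 < c := rpow_pos_of_pos hp1 _
  have hG0 : 0 ≤ G := integral_nonneg fun x => by positivity
  set A := ∫ x, |f x| ^ p * log (|f x| ^ p) with hA
  have hGpos : 0 < G := by
    refine hG0.lt_of_ne' fun hGz => ?_
    have h := key (exp ((A + n + log Z - 1) / n)) (exp_pos _)
    rw [hGz, log_exp, mul_div_cancel₀ _ hnpos.ne'] at h
    linarith
  have hb : 0 < p * c * G / n := by positivity
  have h := key ((p * c * G / n) ^ p⁻¹) (rpow_pos_of_pos hb _)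
  have h1 : ((p * c * G / n) ^ p⁻¹) ^ (-p) = (p * c * G / n)⁻¹ := by
    rw [rpow_neg (rpow_nonneg hb.le _), rpow_inv_rpow hb.le hp0.ne']
  have h2 : c * (p * c * G / n)⁻¹ * G = n / p := by field_simp
  have h3 : log (p * c * G / n) = log p + (p - 1) * log (p - 1) + log G - log n := by
    rw [log_div (by positivity) hnpos.ne', log_mul (by positivity) hGpos.ne',
      log_mul hp0.ne' hc0.ne', hc, log_rpow hp1]
  rw [h1, h2, log_rpow hb, h3] at h
  have h4 : 0 < (p - 1) / exp 1 := div_pos hp1 (exp_pos 1)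
  have h5 : log (Lconst n p * G) =
      log p - log n + (p - 1) * (log (p - 1) - 1) - p / n * log Z + log G := by
    rw [Lconst, ← hZ, log_mul (by positivity) hGpos.ne', log_mul (by positivity) (by positivity),
      log_mul (by positivity) (by positivity), log_rpow hZ0, log_rpow h4,
      log_div hp1.ne' (exp_pos 1).ne', log_exp, log_div hp0.ne' hnpos.ne']
    ring
  rw [h5]
  refine h.trans (le_of_eq ?_)
  field_simp
  ring
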